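/- There is no smooth convex function u : ℝⁿ → ℝ satisfying simultaneously: (1) ∑_{ij}(u^{ij})_{,ij} = 0 where (u^{ij}) is the inverse Hessian; (2) |F|² = u^{ab}_{,cd} u^{cd}_{,ab} ≤ 1; (3) |∇u| < M everywhere for some constant M. -/

import Mathlib

open Matrix
open scoped BigOperators

noncomputable section

/-- Partial derivative of `f` in the `i`-th coordinate direction. -/
def pd {n : ℕ} (f : (Fin n → ℝ) → ℝ) (i : Fin n) : (Fin n → ℝ) → ℝ :=
  fun x => fderiv ℝ f x (Pi.single i 1)

/-- Second partial derivative `∂²f/∂x_k∂x_l`. -/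
def D2 {n : ℕ} (f : (Fin n → ℝ) → ℝ) (k l : Fin n) : (Fin n → ℝ) → ℝ :=
  pd (pd f k) l

/-- The Hessian matrix `(u_{ij})` of `u` at `x`. -/
def hessM {n : ℕ} (u : (Fin n → ℝ) → ℝ) (x : Fin n → ℝ) : Matrix (Fin n) (Fin n) ℝ :=
  Matrix.of fun i j => D2 u i j x

/-- The inverse Hessian matrix `(u^{ij})` of `u` at `x`. -/
def invH {n : ℕ} (u : (Fin n → ℝ) → ℝ) (x : Fin n → ℝ) : Matrix (Fin n) (Fin n) ℝ :=
  (hessM u x)⁻¹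

/-- `|F|² = u^{ij}_{,kl} u^{kl}_{,ij}` (curvature norm squared). -/
def Fsq {n : ℕ} (u : (Fin n → ℝ) → ℝ) (x : Fin n → ℝ) : ℝ :=
  ∑ i, ∑ j, ∑ k, ∑ l,
    D2 (fun y => invH u y i j) k l x * D2 (fun y => invH u y k l) i j x

/-- The scalar curvature `A = −∑ (u^{ij})_{,ij}` (Abreu's formula). -/
def scalA {n : ℕ} (u : (Fin n → ℝ) → ℝ) (x : Fin n → ℝ) : ℝ :=
  -∑ i, ∑ j, D2 (fun y => invH u y i j) i j x

end

noncomputable section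

/-! ### Calculus of partial derivatives -/

section Calculus

variable {n : ℕ}

abbrev Sm (f : (Fin n → ℝ) → ℝ) : Prop := ContDiff ℝ (⊤ : ℕ∞) f

lemma Sm.diff {f : (Fin n → ℝ) → ℝ} (hf : Sm f) (x : Fin n → ℝ) : DifferentiableAt ℝ f x :=
  hf.contDiffAt.differentiableAt (by simp)

lemma Sm.pd {f : (Fin n → ℝ) → ℝ} (hf : Sm f) (i : Fin n) : Sm (pd f i) := by
  unfold _root_.pd
  have h : ContDiff ℝ (⊤ : ℕ∞) (fderiv ℝ f) := hf.fderiv_right (by simp)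
  exact h.clm_apply contDiff_const

lemma pd_comm {f : (Fin n → ℝ) → ℝ} (hf : Sm f) (i j : Fin n) :
    pd (pd f i) j = pd (pd f j) i := by
  have h : ContDiff ℝ (⊤ : ℕ∞) (fderiv ℝ f) := hf.fderiv_right (by simp)
  have key : ∀ (i j : Fin n) x, pd (pd f i) j x
      = fderiv ℝ (fderiv ℝ f) x (Pi.single j 1) (Pi.single i 1) := by
    intro i j x
    have hd : DifferentiableAt ℝ (fderiv ℝ f) x := h.contDiffAt.differentiableAt (by simp)
    have := (hd.hasFDerivAt.clm_apply (hasFDerivAt_const (Pi.single i (1 : ℝ)) x)).fderiv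
    unfold pd
    rw [this]
    simp
  funext x
  rw [key, key]
  have := hf.contDiffAt.isSymmSndFDerivAt (x := x) (by
    rw [minSmoothness_of_isRCLikeNormedField]; exact WithTop.coe_le_coe.mpr le_top)
  exact this _ _

lemma pd_add {f g : (Fin n → ℝ) → ℝ} (hf : Sm f) (hg : Sm g) (i : Fin n) (x : Fin n → ℝ) :
    pd (fun y => f y + g y) i x = pd f i x + pd g i x := by
  unfold pd
  rw [show (fun y => f y + g y) = f + g from rfl, fderiv_add (hf.diff x) (hg.diff x)]
  rfl

lemma pd_neg {f : (Fin n → ℝ) → ℝ} (i : Fin n) (x : Fin n → ℝ) :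
    pd (fun y => - f y) i x = - pd f i x := by
  unfold pd
  rw [fderiv_fun_neg]
  rfl

lemma pd_mul {f g : (Fin n → ℝ) → ℝ} (hf : Sm f) (hg : Sm g) (i : Fin n) (x : Fin n → ℝ) :
    pd (fun y => f y * g y) i x = pd f i x * g x + f x * pd g i x := by
  unfold pd
  rw [fderiv_fun_mul (hf.diff x) (hg.diff x)]
  simp
  ring

lemma pd_sum {ι : Type*} {s : Finset ι} {f : ι → (Fin n → ℝ) → ℝ} (hf : ∀ a, Sm (f a))
    (i : Fin n) (x : Fin n → ℝ) :
    pd (fun y => ∑ a ∈ s, f a y) i x = ∑ a ∈ s, pd (f a) i x := by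
  unfold pd
  rw [fderiv_fun_sum (fun a _ => (hf a).diff x)]
  simp

lemma pd_const (c : ℝ) (i : Fin n) (x : Fin n → ℝ) : pd (fun _ => c) i x = 0 := by
  unfold pd
  simp

lemma fderiv_eq_sum (f : (Fin n → ℝ) → ℝ) (x v : Fin n → ℝ) :
    fderiv ℝ f x v = ∑ i, v i * pd f i x := by
  unfold pd
  conv_lhs => rw [pi_eq_sum_univ' v]
  rw [map_sum]
  refine Finset.sum_congr rfl fun i _ => ?_
  rw [map_smul, smul_eq_mul]

/-- derivative along a line -/
lemma hasDerivAt_line {f : (Fin n → ℝ) → ℝ} (hf : Sm f) (x v : Fin n → ℝ) (t : ℝ) :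
    HasDerivAt (fun s : ℝ => f (x + s • v)) (∑ i, v i * pd f i (x + t • v)) t := by
  rw [← fderiv_eq_sum]
  have h1 : HasDerivAt (fun s : ℝ => x + s • v) v t := by
    simpa using ((hasDerivAt_id t).smul_const v).const_add x
  exact (hf.diff (x + t • v)).hasFDerivAt.comp_hasDerivAt t h1

/-- Entrywise partial derivative of a matrix valued function. -/
def MD (B : (Fin n → ℝ) → Matrix (Fin n) (Fin n) ℝ) (k : Fin n) (x : Fin n → ℝ) :
    Matrix (Fin n) (Fin n) ℝ := Matrix.of fun i j => pd (fun y => B y i j) k x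

abbrev MSm (B : (Fin n → ℝ) → Matrix (Fin n) (Fin n) ℝ) : Prop := ∀ i j, Sm (fun y => B y i j)

lemma MSm.md {B : (Fin n → ℝ) → Matrix (Fin n) (Fin n) ℝ} (hB : MSm B) (k : Fin n) :
    MSm (MD B k) := fun i j => (hB i j).pd k

lemma MSm.mul {B C : (Fin n → ℝ) → Matrix (Fin n) (Fin n) ℝ} (hB : MSm B) (hC : MSm C) :
    MSm (fun y => B y * C y) := fun i j => by
  simp only [Matrix.mul_apply]
  exact ContDiff.sum fun a _ => (hB i a).mul (hC a j)

lemma MD_mul {B C : (Fin n → ℝ) → Matrix (Fin n) (Fin n) ℝ} (hB : MSm B) (hC : MSm C)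
    (k : Fin n) (x : Fin n → ℝ) :
    MD (fun y => B y * C y) k x = MD B k x * C x + B x * MD C k x := by
  ext i j
  simp only [MD, Matrix.of_apply, Matrix.mul_apply, Matrix.add_apply]
  rw [pd_sum (fun a => (hB i a).mul (hC a j)), ← Finset.sum_add_distrib]
  exact Finset.sum_congr rfl fun a _ => pd_mul (hB i a) (hC a j) k x

lemma MD_neg (B : (Fin n → ℝ) → Matrix (Fin n) (Fin n) ℝ) (k : Fin n) (x : Fin n → ℝ) :
    MD (fun y => - B y) k x = - MD B k x := by
  ext i j
  simp only [MD, Matrix.of_apply, Matrix.neg_apply]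
  exact pd_neg k x

lemma Sm_det {B : (Fin n → ℝ) → Matrix (Fin n) (Fin n) ℝ} (hB : MSm B) :
    Sm (fun y => (B y).det) := by
  simp only [Matrix.det_apply]
  refine ContDiff.sum fun σ _ => ?_
  exact (contDiff_prod fun a _ => hB _ _).const_smul _

lemma Sm_adj {B : (Fin n → ℝ) → Matrix (Fin n) (Fin n) ℝ} (hB : MSm B) :
    MSm (fun y => (B y).adjugate) := by
  intro i j
  simp only [Matrix.adjugate_apply]
  apply Sm_det
  intro a b
  by_cases h : a = j
  · subst h
    simpa using contDiff_const
  · simpa [Matrix.updateRow_ne h] using hB a b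

lemma MSm_inv {B : (Fin n → ℝ) → Matrix (Fin n) (Fin n) ℝ} (hB : MSm B)
    (h0 : ∀ y, (B y).det ≠ 0) : MSm (fun y => (B y)⁻¹) := by
  intro i j
  simp only [Matrix.inv_def, Ring.inverse_eq_inv', Matrix.smul_apply, smul_eq_mul]
  exact ((Sm_det hB).inv h0).mul (Sm_adj hB i j)

lemma MD_inv {B : (Fin n → ℝ) → Matrix (Fin n) (Fin n) ℝ} (hB : MSm B)
    (h0 : ∀ y, (B y).det ≠ 0) (k : Fin n) (x : Fin n → ℝ) :
    MD (fun y => (B y)⁻¹) k x = - ((B x)⁻¹ * MD B k x * (B x)⁻¹) := by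
  have hI := MSm_inv hB h0
  have h1 := MD_mul hI hB k x
  have hu : ∀ y, IsUnit (B y).det := fun y => isUnit_iff_ne_zero.mpr (h0 y)
  have h2 : (fun y => (B y)⁻¹ * B y) = fun _ => 1 := by
    funext y
    exact Matrix.nonsing_inv_mul _ (hu y)
  rw [h2] at h1
  have h3 : MD (fun _ : Fin n → ℝ => (1 : Matrix (Fin n) (Fin n) ℝ)) k x = 0 := by
    ext i j
    exact pd_const _ _ _
  rw [h3] at h1
  have h4 : MD (fun y => (B y)⁻¹) k x * B x = - ((B x)⁻¹ * MD B k x) :=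
    eq_neg_of_add_eq_zero_left h1.symm
  calc MD (fun y => (B y)⁻¹) k x = MD (fun y => (B y)⁻¹) k x * (B x * (B x)⁻¹) := by
        rw [Matrix.mul_nonsing_inv _ (hu x), Matrix.mul_one]
    _ = _ := by rw [← Matrix.mul_assoc, h4, Matrix.neg_mul]

/-- Jacobi's formula. -/
lemma pd_det {B : (Fin n → ℝ) → Matrix (Fin n) (Fin n) ℝ} (hB : MSm B)
    (h0 : ∀ y, (B y).det ≠ 0) (k : Fin n) (x : Fin n → ℝ) :
    pd (fun y => (B y).det) k x = (B x).det * ((B x)⁻¹ * MD B k x).trace := by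
  have h1 : pd (fun y => (B y).det) k x
      = ∑ i, ((B x).updateCol i (fun j => pd (fun y => B y j i) k x)).det := by
    simp only [Matrix.det_apply', pd]
    have hp : ∀ σ : Equiv.Perm (Fin n), HasFDerivAt (fun y => ∏ i, B y (σ i) i)
        (∑ i, (∏ j ∈ Finset.univ.erase i, B x (σ j) j) • fderiv ℝ (fun y => B y (σ i) i) x) x :=
      fun σ => HasFDerivAt.finsetProd fun i _ => ((hB (σ i) i).diff x).hasFDerivAt
    have hs := HasFDerivAt.fun_sum (u := Finset.univ)
      fun (σ : Equiv.Perm (Fin n)) _ => (hp σ).const_mul ((Equiv.Perm.sign σ : ℤ) : ℝ)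
    rw [hs.fderiv]
    rw [Finset.sum_comm]
    simp only [_root_.sum_apply, _root_.smul_apply, smul_eq_mul,
      Finset.mul_sum]
    refine Finset.sum_congr rfl fun σ _ => Finset.sum_congr rfl fun i _ => ?_
    congr 1
    rw [← Finset.mul_prod_erase Finset.univ _ (Finset.mem_univ i), mul_comm]
    congr 1
    · simp
    · refine Finset.prod_congr rfl fun j hj => ?_
      rw [Matrix.updateCol_ne (Finset.ne_of_mem_erase hj)]
  have hu : IsUnit (B x).det := isUnit_iff_ne_zero.mpr (h0 x)
  rw [h1, Matrix.inv_def, Ring.inverse_eq_inv', Matrix.smul_mul, Matrix.trace_smul, smul_eq_mul,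
    ← mul_assoc, mul_inv_cancel₀ (h0 x), one_mul, Matrix.trace]
  refine Finset.sum_congr rfl fun i _ => ?_
  rw [← Matrix.cramer_apply, Matrix.cramer_eq_adjugate_mulVec]
  rfl

end Calculus
/-! ### Linear algebra -/

section Algebra

open scoped Kronecker MatrixOrder

lemma core_cs {N : Type*} [Fintype N] [DecidableEq N] (Q Qi R : Matrix N N ℝ)
    (hQ : Q * Qi = 1) (hR : Rᵀ = R)
    (h : ((Q * Qᵀ * R) * (Q * Qᵀ * R)).trace ≤ 1) (w z : N → ℝ) :
    (w ⬝ᵥ (Q * Qᵀ * R) *ᵥ z) ^ 2 ≤ (w ⬝ᵥ (Q * Qᵀ) *ᵥ w) * (z ⬝ᵥ (Qiᵀ * Qi) *ᵥ z) := by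
  set S := Qᵀ * R * Q with hS
  set a := Qᵀ *ᵥ w with ha
  set b := Qi *ᵥ z with hb
  have hSt : Sᵀ = S := by
    simp only [hS, Matrix.transpose_mul, Matrix.transpose_transpose, hR, Matrix.mul_assoc]
  have h1 : w ⬝ᵥ (Q * Qᵀ * R) *ᵥ z = a ⬝ᵥ S *ᵥ b := by
    have : S *ᵥ b = (Qᵀ * R) *ᵥ z := by
      rw [hS, hb, Matrix.mulVec_mulVec, Matrix.mul_assoc (Qᵀ * R), hQ, Matrix.mul_one]
    rw [this, ha, Matrix.mulVec_transpose, ← Matrix.dotProduct_mulVec, Matrix.mulVec_mulVec,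
      Matrix.mul_assoc]
  have h2 : w ⬝ᵥ (Q * Qᵀ) *ᵥ w = a ⬝ᵥ a := by
    rw [← Matrix.mulVec_mulVec, ← ha, Matrix.dotProduct_mulVec, ← Matrix.mulVec_transpose]
  have h3 : z ⬝ᵥ (Qiᵀ * Qi) *ᵥ z = b ⬝ᵥ b := by
    rw [← Matrix.mulVec_mulVec, ← hb, Matrix.dotProduct_mulVec, Matrix.vecMul_transpose]
  have h4 : ((Q * Qᵀ * R) * (Q * Qᵀ * R)).trace = ∑ i, ∑ j, S i j ^ 2 := by
    have : ((Q * Qᵀ * R) * (Q * Qᵀ * R)).trace = (S * Sᵀ).trace := by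
      rw [hSt, hS, show (Q * Qᵀ * R) * (Q * Qᵀ * R) = Q * (Qᵀ * R * Q * Qᵀ * R) by
        simp only [Matrix.mul_assoc], Matrix.trace_mul_comm]
      simp only [Matrix.mul_assoc]
    rw [this, Matrix.trace]
    simp only [Matrix.diag_apply, Matrix.mul_apply, Matrix.transpose_apply, sq]
  rw [h4] at h
  rw [h1, h2, h3]
  have h5 : (a ⬝ᵥ S *ᵥ b) ^ 2 ≤ (∑ i, a i ^ 2) * ∑ i, (S *ᵥ b) i ^ 2 :=
    Finset.sum_mul_sq_le_sq_mul_sq _ _ _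
  have h6 : ∑ i, (S *ᵥ b) i ^ 2 ≤ ∑ i, (∑ j, S i j ^ 2) * ∑ j, b j ^ 2 :=
    Finset.sum_le_sum fun i _ => Finset.sum_mul_sq_le_sq_mul_sq _ _ _
  rw [← Finset.sum_mul] at h6
  have hA : 0 ≤ ∑ i, a i ^ 2 := Finset.sum_nonneg fun i _ => sq_nonneg _
  have hB : 0 ≤ ∑ i, b i ^ 2 := Finset.sum_nonneg fun i _ => sq_nonneg _
  have h7 : a ⬝ᵥ a = ∑ i, a i ^ 2 := by simp [dotProduct, sq]
  have h8 : b ⬝ᵥ b = ∑ i, b i ^ 2 := by simp [dotProduct, sq]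
  rw [h7, h8]
  calc _ ≤ _ := h5
    _ ≤ _ := mul_le_mul_of_nonneg_left (h6.trans (by nlinarith)) hA

lemma posDef_factor {n : ℕ} {H : Matrix (Fin n) (Fin n) ℝ} (hH : H.PosDef) :
    ∃ P Pi : Matrix (Fin n) (Fin n) ℝ, P * Pi = 1 ∧ H⁻¹ = P * Pᵀ ∧ H = Piᵀ * Pi := by
  obtain ⟨y, hy, h⟩ := CStarAlgebra.isStrictlyPositive_iff_eq_star_mul_self.mp
    hH.isStrictlyPositive
  have hy' : IsUnit y.det := (Matrix.isUnit_iff_isUnit_det y).mp hy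
  have h' : H = yᵀ * y := by rw [h]; rfl
  refine ⟨y⁻¹, y, Matrix.nonsing_inv_mul _ hy', ?_, h'⟩
  rw [h', Matrix.mul_inv_rev, Matrix.transpose_nonsing_inv]

lemma kron_form {n : ℕ} (A : Matrix (Fin n) (Fin n) ℝ) (v : Fin n → ℝ) :
    (fun p : Fin n × Fin n => v p.1 * v p.2) ⬝ᵥ (A ⊗ₖ A) *ᵥ (fun p => v p.1 * v p.2)
      = (v ⬝ᵥ A *ᵥ v) ^ 2 := by
  have e : v ⬝ᵥ A *ᵥ v = ∑ i, ∑ k, v i * (A i k * v k) := by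
    simp only [dotProduct, mulVec, Finset.mul_sum]
  rw [e, sq, Finset.sum_mul_sum]
  simp only [dotProduct, mulVec, Fintype.sum_prod_type, Matrix.kroneckerMap_apply, Finset.mul_sum]
  refine Finset.sum_congr rfl fun i _ => Finset.sum_congr rfl fun j _ => ?_
  simp only [← Finset.mul_sum]
  rw [Finset.mul_sum, Finset.mul_sum, Finset.mul_sum, Finset.sum_mul_sum]
  simp only [Finset.mul_sum]
  refine Finset.sum_congr rfl fun k _ => Finset.sum_congr rfl fun l _ => ?_
  ring

lemma tensor_bound {n : ℕ} {H : Matrix (Fin n) (Fin n) ℝ} (hH : H.PosDef)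
    (R : Matrix (Fin n × Fin n) (Fin n × Fin n) ℝ) (hR : Rᵀ = R)
    (h : (((H⁻¹ ⊗ₖ H⁻¹) * R) * ((H⁻¹ ⊗ₖ H⁻¹) * R)).trace ≤ 1) (ξ ν : Fin n → ℝ) :
    |(fun p : Fin n × Fin n => ξ p.1 * ξ p.2) ⬝ᵥ ((H⁻¹ ⊗ₖ H⁻¹) * R) *ᵥ
      (fun p => ν p.1 * ν p.2)| ≤ (ν ⬝ᵥ H *ᵥ ν) * (ξ ⬝ᵥ H⁻¹ *ᵥ ξ) := by
  obtain ⟨P, Pi, h1, h2, h3⟩ := posDef_factor hH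
  have hK : H⁻¹ ⊗ₖ H⁻¹ = (P ⊗ₖ P) * (P ⊗ₖ P)ᵀ := by
    rw [h2, Matrix.mul_kronecker_mul, Matrix.kroneckerMap_transpose]
  have hK' : H ⊗ₖ H = (Pi ⊗ₖ Pi)ᵀ * (Pi ⊗ₖ Pi) := by
    rw [h3, Matrix.mul_kronecker_mul, Matrix.kroneckerMap_transpose]
  have hQ : (P ⊗ₖ P) * (Pi ⊗ₖ Pi) = 1 := by
    rw [← Matrix.mul_kronecker_mul, h1, Matrix.one_kronecker_one]
  rw [hK] at h
  have := core_cs _ _ R hQ hR h (fun p => ξ p.1 * ξ p.2) (fun p => ν p.1 * ν p.2)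
  rw [← hK, ← hK', kron_form, kron_form] at this
  refine abs_le_of_sq_le_sq (this.trans_eq (by ring)) ?_
  have e1 := hH.posSemidef.dotProduct_mulVec_nonneg ν
  have e2 := hH.inv.posSemidef.dotProduct_mulVec_nonneg ξ
  simp only [star_trivial] at e1 e2
  positivity

/-- Cauchy-Schwarz for a form and its inverse. -/
lemma inv_cs {n : ℕ} {H : Matrix (Fin n) (Fin n) ℝ} (hH : H.PosDef) (ξ ν : Fin n → ℝ) :
    (ξ ⬝ᵥ ν) ^ 2 ≤ (ν ⬝ᵥ H *ᵥ ν) * (ξ ⬝ᵥ H⁻¹ *ᵥ ξ) := by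
  obtain ⟨P, Pi, h1, h2, h3⟩ := posDef_factor hH
  have e1 : ν ⬝ᵥ H *ᵥ ν = ∑ i, (Pi *ᵥ ν) i ^ 2 := by
    rw [h3, ← Matrix.mulVec_mulVec, Matrix.dotProduct_mulVec, Matrix.vecMul_transpose]
    simp [dotProduct, sq]
  have e2 : ξ ⬝ᵥ H⁻¹ *ᵥ ξ = ∑ i, (Pᵀ *ᵥ ξ) i ^ 2 := by
    rw [h2, ← Matrix.mulVec_mulVec, Matrix.dotProduct_mulVec, ← Matrix.mulVec_transpose]
    simp [dotProduct, sq]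
  have e3 : ξ ⬝ᵥ ν = ∑ i, (Pᵀ *ᵥ ξ) i * (Pi *ᵥ ν) i := by
    change _ = (Pᵀ *ᵥ ξ) ⬝ᵥ (Pi *ᵥ ν)
    rw [Matrix.mulVec_transpose, ← Matrix.dotProduct_mulVec, Matrix.mulVec_mulVec, h1,
      Matrix.one_mulVec]
  rw [e1, e2, e3, mul_comm]
  exact Finset.sum_mul_sq_le_sq_mul_sq _ _ _

/-- trace of product of a positive and a nonpositive form -/
lemma trace_nonpos {n : ℕ} {H : Matrix (Fin n) (Fin n) ℝ} (hH : H.PosDef)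
    (W : Matrix (Fin n) (Fin n) ℝ) (hW : ∀ v : Fin n → ℝ, ∑ i, ∑ j, v i * v j * W i j ≤ 0) :
    ∑ i, ∑ j, H⁻¹ i j * W i j ≤ 0 := by
  obtain ⟨P, Pi, h1, h2, h3⟩ := posDef_factor hH
  have : ∑ i, ∑ j, H⁻¹ i j * W i j = ∑ k, ∑ i, ∑ j, P i k * P j k * W i j := by
    rw [Finset.sum_comm]
    conv_rhs => rw [Finset.sum_comm]; enter [2, i]; rw [Finset.sum_comm]
    rw [Finset.sum_comm]
    refine Finset.sum_congr rfl fun i _ => Finset.sum_congr rfl fun j _ => ?_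
    rw [h2, Matrix.mul_apply, Finset.sum_mul]
    rfl
  rw [this]
  exact Finset.sum_nonpos fun k _ => hW fun i => P i k

lemma det_bound {n : ℕ} {H : Matrix (Fin n) (Fin n) ℝ} (hH : H.PosDef) {C : ℝ} (hC : 1 ≤ C)
    (hb : ∀ i j, |H i j| ≤ C) (ν : Fin n → ℝ) (hν : ‖ν‖ = 1) :
    H.det ≤ (ν ⬝ᵥ H *ᵥ ν) * (n * (n * ((Nat.factorial n : ℝ) * C ^ n))) := by
  have hadj : ∀ i j, |H.adjugate i j| ≤ (Nat.factorial n : ℝ) * C ^ n := by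
    intro i j
    rw [Matrix.adjugate_apply]
    have := Matrix.det_le (A := H.updateRow j (Pi.single i 1)) (abv := AbsoluteValue.abs)
      (x := C) (fun a b => by
        by_cases h : a = j
        · subst h
          by_cases h' : b = i
          · subst h'; simpa using hC
          · simp [h']; linarith
        · simpa [Matrix.updateRow_ne h] using hb a b)
    simpa using this
  have hdet := hH.det_pos
  have hν1 : ∀ i, |ν i| ≤ 1 := fun i => by
    have := norm_le_pi_norm ν i
    rwa [hν, Real.norm_eq_abs] at this
  have h1 : H.det * (ν ⬝ᵥ H⁻¹ *ᵥ ν) = ν ⬝ᵥ H.adjugate *ᵥ ν := by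
    rw [Matrix.inv_def, Ring.inverse_eq_inv', Matrix.smul_mulVec, dotProduct_smul, smul_eq_mul,
      ← mul_assoc, mul_inv_cancel₀ hdet.ne', one_mul]
  have h2 : ν ⬝ᵥ H.adjugate *ᵥ ν ≤ (n * (n * ((Nat.factorial n : ℝ) * C ^ n))) := by
    simp only [dotProduct, mulVec, Finset.mul_sum]
    have : ∀ i ∈ Finset.univ, ∑ j, ν i * (H.adjugate i j * ν j)
        ≤ n * ((Nat.factorial n : ℝ) * C ^ n) := by
      intro i _
      refine (Finset.sum_le_card_nsmul _ _ ((Nat.factorial n : ℝ) * C ^ n) ?_).trans_eq (by simp)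
      intro j _
      refine (le_abs_self _).trans ?_
      rw [abs_mul, abs_mul]
      have a1 := hadj i j
      have a2 := hν1 i
      have a3 := hν1 j
      calc |ν i| * (|H.adjugate i j| * |ν j|) ≤ 1 * (((Nat.factorial n : ℝ) * C ^ n) * 1) := by
            gcongr
        _ = _ := by ring
    exact (Finset.sum_le_card_nsmul _ _ _ this).trans_eq (by simp)
  have h3 : 1 ≤ ν ⬝ᵥ ν := by
    have : ‖ν‖ ≤ Real.sqrt (ν ⬝ᵥ ν) := by
      refine (pi_norm_le_iff_of_nonneg (Real.sqrt_nonneg _)).mpr fun i => ?_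
      rw [Real.norm_eq_abs]
      refine Real.abs_le_sqrt ?_
      rw [sq]
      exact Finset.single_le_sum (f := fun i => ν i * ν i) (fun i _ => mul_self_nonneg _)
        (Finset.mem_univ i)
    rw [hν] at this
    exact Real.one_le_sqrt.mp this
  have h4 := inv_cs hH ν ν
  have e1 := hH.posSemidef.dotProduct_mulVec_nonneg ν
  simp only [star_trivial] at e1
  have h5 : 1 ≤ (ν ⬝ᵥ H *ᵥ ν) * (ν ⬝ᵥ H⁻¹ *ᵥ ν) := by nlinarith
  calc H.det ≤ H.det * ((ν ⬝ᵥ H *ᵥ ν) * (ν ⬝ᵥ H⁻¹ *ᵥ ν)) := le_mul_of_one_le_right hdet.le h5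
    _ = (ν ⬝ᵥ H *ᵥ ν) * (ν ⬝ᵥ H.adjugate *ᵥ ν) := by rw [← h1]; ring
    _ ≤ _ := mul_le_mul_of_nonneg_left h2 e1

end Algebra

/-! ### One dimensional estimate -/

section OneDim

lemma one_dim_aux {g φ k k' k'' : ℝ → ℝ} (hg : ∀ t, HasDerivAt g (φ t) t)
    (hk : ∀ t, HasDerivAt k (k' t) t) (hk' : ∀ t, HasDerivAt k' (k'' t) t)
    (hφ : ∀ t, 0 < φ t) (hkφ : ∀ t, 1 ≤ k t * φ t) (h0 : k 0 * φ 0 = 1)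
    (hb : ∀ t, k'' t ≤ φ t * k t) {ε L : ℝ} (hL : 0 < L) (hε : g L - g 0 ≤ ε)
    (hεL : ε * L ≤ 1 / 2) (hneg : k' 0 ≤ 0) : φ 0 ≤ 2 * ε / L := by
  have hkpos : ∀ t, 0 < k t := fun t => by
    by_contra h
    have := hkφ t
    nlinarith [hφ t, mul_nonneg (sub_nonneg.2 (not_lt.1 h)) (hφ t).le]
  have hkc : Continuous k := continuous_iff_continuousAt.2 fun t => (hk t).continuousAt
  have hgm : Monotone g := monotone_of_hasDerivAt_nonneg hg (fun t => (hφ t).le)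
  obtain ⟨tm, htm, hmax⟩ := isCompact_Icc.exists_isMaxOn (Set.nonempty_Icc.2 hL.le)
    hkc.continuousOn
  set K := k tm with hK
  have hKpos : 0 < K := hkpos tm
  have hmax' : ∀ t ∈ Set.Icc 0 L, k t ≤ K := fun t ht => hmax ht
  have A1 : AntitoneOn (fun t => k' t - K * g t) (Set.Icc 0 L) := by
    have hd : ∀ t, HasDerivAt (fun t => k' t - K * g t) (k'' t - K * φ t) t := fun t =>
      (hk' t).sub ((hg t).const_mul K)
    refine antitoneOn_of_deriv_nonpos (convex_Icc 0 L)
      (fun t _ => (hd t).continuousAt.continuousWithinAt)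
      (fun t _ => (hd t).differentiableAt.differentiableWithinAt) fun t ht => ?_
    rw [(hd t).deriv]
    have := hmax' t (interior_subset ht)
    nlinarith [hb t, hφ t]
  have hk'b : ∀ t ∈ Set.Icc 0 L, k' t ≤ K * ε := by
    intro t ht
    have h1 := A1 (Set.left_mem_Icc.2 hL.le) ht ht.1
    have h2 : g t ≤ g L := hgm ht.2
    simp only at h1
    nlinarith
  have A2 : AntitoneOn (fun t => k t - K * ε * t) (Set.Icc 0 L) := by
    have hd : ∀ t, HasDerivAt (fun t => k t - K * ε * t) (k' t - K * ε) t := fun t => by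
      simpa using (hk t).fun_sub ((hasDerivAt_id t).const_mul (K * ε))
    refine antitoneOn_of_deriv_nonpos (convex_Icc 0 L)
      (fun t _ => (hd t).continuousAt.continuousWithinAt)
      (fun t _ => (hd t).differentiableAt.differentiableWithinAt) fun t ht => ?_
    rw [(hd t).deriv]
    have := hk'b t (interior_subset ht)
    linarith
  have hε0 : 0 ≤ ε := by linarith [hgm hL.le]
  have hK2 : K ≤ 2 * k 0 := by
    have h1 := A2 (Set.left_mem_Icc.2 hL.le) htm htm.1
    simp only [mul_zero, sub_zero] at h1
    have : K * ε * tm ≤ K * (1 / 2) := by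
      rw [mul_assoc]
      refine mul_le_mul_of_nonneg_left (le_trans ?_ hεL) hKpos.le
      exact mul_le_mul_of_nonneg_left htm.2 hε0
    linarith
  have hφl : ∀ t ∈ Set.Icc 0 L, φ 0 / 2 ≤ φ t := by
    intro t ht
    have h1 := hmax' t ht
    have h2 := hkφ t
    have h3 : 1 ≤ 2 * k 0 * φ t := by nlinarith [hφ t]
    have h4 : 0 < φ 0 := hφ 0
    have : φ 0 * 1 ≤ φ 0 * (2 * k 0 * φ t) := mul_le_mul_of_nonneg_left h3 h4.le
    have e : φ 0 * (2 * k 0 * φ t) = 2 * (k 0 * φ 0) * φ t := by ring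
    rw [e, h0] at this
    linarith
  have A3 : MonotoneOn (fun t => g t - φ 0 / 2 * t) (Set.Icc 0 L) := by
    have hd : ∀ t, HasDerivAt (fun t => g t - φ 0 / 2 * t) (φ t - φ 0 / 2) t := fun t => by
      simpa using (hg t).fun_sub ((hasDerivAt_id t).const_mul (φ 0 / 2))
    refine monotoneOn_of_deriv_nonneg (convex_Icc 0 L)
      (fun t _ => (hd t).continuousAt.continuousWithinAt)
      (fun t _ => (hd t).differentiableAt.differentiableWithinAt) fun t ht => ?_
    rw [(hd t).deriv]
    have := hφl t (interior_subset ht)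
    linarith
  have h1 := A3 (Set.left_mem_Icc.2 hL.le) (Set.right_mem_Icc.2 hL.le) hL.le
  simp only [mul_zero, sub_zero] at h1
  rw [le_div_iff₀ hL]
  linarith

lemma one_dim {g φ k k' k'' : ℝ → ℝ} (hg : ∀ t, HasDerivAt g (φ t) t)
    (hk : ∀ t, HasDerivAt k (k' t) t) (hk' : ∀ t, HasDerivAt k' (k'' t) t)
    (hφ : ∀ t, 0 < φ t) (hkφ : ∀ t, 1 ≤ k t * φ t) (h0 : k 0 * φ 0 = 1)
    (hb : ∀ t, k'' t ≤ φ t * k t) {ε L : ℝ} (hL : 0 < L) (hε : g L - g (-L) ≤ ε)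
    (hεL : ε * L ≤ 1 / 2) : φ 0 ≤ 2 * ε / L := by
  have hgm : Monotone g := monotone_of_hasDerivAt_nonneg hg (fun t => (hφ t).le)
  have m1 := hgm hL.le
  have m2 := hgm (neg_nonpos.2 hL.le)
  rcases le_total (k' 0) 0 with h | h
  · exact one_dim_aux hg hk hk' hφ hkφ h0 hb hL (by linarith) hεL h
  · have hn : ∀ t : ℝ, HasDerivAt (fun s : ℝ => -s) (-1) t := fun t => hasDerivAt_neg t
    have hg' : ∀ t, HasDerivAt (fun s => - g (-s)) (φ (-t)) t := fun t => by
      exact (((hg (-t)).comp t (hn t)).neg).congr_deriv (by ring)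
    have hk1 : ∀ t, HasDerivAt (fun s => k (-s)) (- k' (-t)) t := fun t => by
      exact ((hk (-t)).comp t (hn t)).congr_deriv (by ring)
    have hk2 : ∀ t, HasDerivAt (fun s => - k' (-s)) (k'' (-t)) t := fun t => by
      exact (((hk' (-t)).comp t (hn t)).neg).congr_deriv (by ring)
    have := one_dim_aux (φ := fun t => φ (-t)) hg' hk1 hk2 (fun t => hφ _) (fun t => hkφ _)
      (by simpa using h0) (fun t => hb _) hL (ε := ε) (by simp only [neg_zero]; linarith) hεL
      (by simpa using h)
    simpa using this

end OneDim
/-! ### Geometry of the Hessian metric -/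

section Geometry

open scoped Kronecker

variable {n : ℕ} {u : (Fin n → ℝ) → ℝ}

lemma hess_sm (hu : Sm u) : MSm (hessM u) := fun i j => (hu.pd i).pd j

lemma hess_det_ne (hH : ∀ x, (hessM u x).PosDef) (x : Fin n → ℝ) : (hessM u x).det ≠ 0 :=
  (hH x).det_pos.ne'

lemma inv_sm (hu : Sm u) (hH : ∀ x, (hessM u x).PosDef) : MSm (invH u) :=
  MSm_inv (hess_sm hu) (hess_det_ne hH)

lemma inv_symm (hH : ∀ x, (hessM u x).PosDef) (x : Fin n → ℝ) (i j : Fin n) :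
    invH u x i j = invH u x j i := by
  have := (hH x).inv.isHermitian.apply j i
  simpa [invH] using this

lemma MD_invH (hu : Sm u) (hH : ∀ x, (hessM u x).PosDef) (k : Fin n) (x : Fin n → ℝ) :
    MD (invH u) k x = - (invH u x * MD (hessM u) k x * invH u x) :=
  MD_inv (hess_sm hu) (hess_det_ne hH) k x

lemma T_symm1 (hu : Sm u) (x : Fin n → ℝ) (i j k : Fin n) :
    MD (hessM u) k x i j = MD (hessM u) k x j i := by
  change pd (pd (pd u i) j) k x = pd (pd (pd u j) i) k x
  rw [pd_comm hu]

lemma T_symm2 (hu : Sm u) (x : Fin n → ℝ) (i j k : Fin n) :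
    MD (hessM u) k x i j = MD (hessM u) j x i k := by
  change pd (pd (pd u i) j) k x = pd (pd (pd u i) k) j x
  rw [pd_comm (hu.pd i)]

/-- The curvature tensor with lowered indices. -/
def Rten (u : (Fin n → ℝ) → ℝ) (x : Fin n → ℝ) :
    Matrix (Fin n × Fin n) (Fin n × Fin n) ℝ :=
  Matrix.of fun p q =>
    (MD (hessM u) q.2 x * invH u x * MD (hessM u) q.1 x
      + MD (hessM u) q.1 x * invH u x * MD (hessM u) q.2 x
      - MD (MD (hessM u) q.1) q.2 x) p.1 p.2

lemma triple_apply (B C D : Matrix (Fin n) (Fin n) ℝ) (i j : Fin n) :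
    (B * C * D) i j = ∑ p, ∑ q, B i p * C p q * D q j := by
  simp only [Matrix.mul_apply, Finset.sum_mul]
  rw [Finset.sum_comm]

lemma Rten_symm (hu : Sm u) (hH : ∀ x, (hessM u x).PosDef) (x : Fin n → ℝ) :
    (Rten u x)ᵀ = Rten u x := by
  ext ⟨a, b⟩ ⟨k, l⟩
  simp only [Rten, Matrix.transpose_apply, Matrix.of_apply, Matrix.add_apply, Matrix.sub_apply,
    triple_apply]
  have h4 : MD (MD (hessM u) a) b x k l = MD (MD (hessM u) k) l x a b := by
    change pd (pd (pd (pd u k) l) a) b x = pd (pd (pd (pd u a) b) k) l x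
    rw [pd_comm (hu.pd k) l a, pd_comm hu k a, pd_comm ((hu.pd a).pd k) l b,
      pd_comm (hu.pd a) k b]
  rw [h4]
  congr 2
  · rw [Finset.sum_comm]
    refine Finset.sum_congr rfl fun p _ => Finset.sum_congr rfl fun q _ => ?_
    rw [inv_symm hH x q p, T_symm2 hu x k q b, T_symm1 hu x k b, T_symm2 hu x b k q,
      T_symm1 hu x b q, T_symm2 hu x q b k, T_symm1 hu x p l a, T_symm2 hu x l p a,
      T_symm1 hu x l a, T_symm2 hu x a l p]
    ring
  · refine Finset.sum_congr rfl fun p _ => Finset.sum_congr rfl fun q _ => ?_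
    rw [T_symm1 hu x k p a, T_symm2 hu x p k a, T_symm1 hu x p a k, T_symm2 hu x q l b]

lemma D2_invH (hu : Sm u) (hH : ∀ x, (hessM u x).PosDef) (x : Fin n → ℝ) (i j k l : Fin n) :
    D2 (fun y => invH u y i j) k l x
      = ((((hessM u x)⁻¹ ⊗ₖ (hessM u x)⁻¹) * Rten u x) : Matrix _ _ ℝ) (i, j) (k, l) := by
  have hA := inv_sm hu hH
  have hT := hess_sm hu
  have e1 : D2 (fun y => invH u y i j) k l x = MD (MD (invH u) k) l x i j := rfl
  have e2 : MD (invH u) k = fun y => - (invH u y * MD (hessM u) k y * invH u y) := by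
    funext y
    exact MD_invH hu hH k y
  have e3 : MD (MD (invH u) k) l x = invH u x *
      (MD (hessM u) l x * invH u x * MD (hessM u) k x
      + MD (hessM u) k x * invH u x * MD (hessM u) l x
      - MD (MD (hessM u) k) l x) * invH u x := by
    rw [e2, MD_neg, MD_mul (hA.mul (hT.md k)) hA, MD_mul hA (hT.md k), MD_invH hu hH]
    noncomm_ring
  rw [e1, e3, triple_apply, Matrix.mul_apply, Fintype.sum_prod_type]
  refine Finset.sum_congr rfl fun p _ => Finset.sum_congr rfl fun q _ => ?_
  rw [inv_symm hH x q j]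
  simp only [Rten, Matrix.kroneckerMap_apply, Matrix.of_apply, invH]
  ring

lemma curv_bound (hu : Sm u) (hH : ∀ x, (hessM u x).PosDef) (hF : ∀ x, Fsq u x ≤ 1)
    (x ξ ν : Fin n → ℝ) :
    |∑ i, ∑ j, ∑ k, ∑ l, ξ i * ξ j * (ν k * ν l) * D2 (fun y => invH u y i j) k l x|
      ≤ (ν ⬝ᵥ hessM u x *ᵥ ν) * (ξ ⬝ᵥ invH u x *ᵥ ξ) := by
  have h := hF x
  have h1 : ((((hessM u x)⁻¹ ⊗ₖ (hessM u x)⁻¹) * Rten u x) *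
      (((hessM u x)⁻¹ ⊗ₖ (hessM u x)⁻¹) * Rten u x)).trace = Fsq u x := by
    simp only [Fsq, D2_invH hu hH]
    rw [Matrix.trace, Fintype.sum_prod_type]
    refine Finset.sum_congr rfl fun p _ => Finset.sum_congr rfl fun q _ => ?_
    rw [Matrix.diag_apply, Matrix.mul_apply, Fintype.sum_prod_type]
  rw [← h1] at h
  have h2 := tensor_bound (hH x) (Rten u x) (Rten_symm hu hH x) h ξ ν
  refine le_trans (le_of_eq ?_) h2
  congr 1
  simp only [D2_invH hu hH]
  rw [dotProduct, Fintype.sum_prod_type]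
  refine Finset.sum_congr rfl fun p _ => Finset.sum_congr rfl fun q _ => ?_
  rw [mulVec, dotProduct, Fintype.sum_prod_type, Finset.mul_sum]
  refine Finset.sum_congr rfl fun k _ => ?_
  rw [Finset.mul_sum]
  refine Finset.sum_congr rfl fun l _ => ?_
  ring

lemma hasDerivAt_line2 {f : (Fin n → ℝ) → ℝ} (hf : Sm f) (x v : Fin n → ℝ) (t : ℝ) :
    HasDerivAt (fun s : ℝ => ∑ i, v i * pd f i (x + s • v))
      (∑ i, ∑ j, v i * v j * D2 f i j (x + t • v)) t := by
  have := HasDerivAt.fun_sum (u := Finset.univ)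
    fun (i : Fin n) _ => (hasDerivAt_line (hf.pd i) x v t).const_mul (v i)
  refine this.congr_deriv ?_
  refine Finset.sum_congr rfl fun i _ => ?_
  rw [Finset.mul_sum]
  refine Finset.sum_congr rfl fun j _ => ?_
  rw [mul_assoc]
  rfl

lemma hess_form (x v : Fin n → ℝ) :
    v ⬝ᵥ hessM u x *ᵥ v = ∑ i, ∑ j, v i * v j * D2 u i j x := by
  simp only [dotProduct, mulVec, Finset.mul_sum]
  refine Finset.sum_congr rfl fun i _ => Finset.sum_congr rfl fun j _ => ?_
  simp only [hessM, Matrix.of_apply]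
  ring

lemma hess_bound (hu : Sm u) (hH : ∀ x, (hessM u x).PosDef) (hF : ∀ x, Fsq u x ≤ 1)
    (x ν : Fin n → ℝ) (hν : ν ≠ 0) {ε L : ℝ} (hL : 0 < L) (hεL : ε * L ≤ 1 / 2)
    (hε : fderiv ℝ u (x + L • ν) ν - fderiv ℝ u (x + (-L) • ν) ν ≤ ε) :
    ν ⬝ᵥ hessM u x *ᵥ ν ≤ 2 * ε / L := by
  have hpos : ∀ y, 0 < ν ⬝ᵥ hessM u y *ᵥ ν := fun y => by
    simpa using (hH y).dotProduct_mulVec_pos hν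
  set φ0 := ν ⬝ᵥ hessM u x *ᵥ ν with hφ0
  have hφ0p : 0 < φ0 := hpos x
  set ξ : Fin n → ℝ := φ0⁻¹ • (hessM u x *ᵥ ν) with hξ
  have hA := inv_sm hu hH
  set q : (Fin n → ℝ) → ℝ := fun y => ∑ i, ∑ j, ξ i * ξ j * invH u y i j with hq
  have hqs : Sm q := ContDiff.sum fun i _ => ContDiff.sum fun j _ => contDiff_const.mul (hA i j)
  have hqf : ∀ y, q y = ξ ⬝ᵥ invH u y *ᵥ ξ := fun y => by
    simp only [hq, dotProduct, mulVec, Finset.mul_sum]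
    refine Finset.sum_congr rfl fun i _ => Finset.sum_congr rfl fun j _ => ?_
    ring
  have hqpd : ∀ k, pd q k = fun y => ∑ i, ∑ j, ξ i * ξ j * pd (fun y => invH u y i j) k y := by
    intro k
    funext y
    rw [hq, pd_sum (fun i => ContDiff.sum fun j _ => contDiff_const.mul (hA i j))]
    refine Finset.sum_congr rfl fun i _ => ?_
    rw [pd_sum (fun j => contDiff_const.mul (hA i j))]
    refine Finset.sum_congr rfl fun j _ => ?_
    rw [pd_mul contDiff_const (hA i j), pd_const]
    ring
  have hqD : ∀ k l y, D2 q k l y = ∑ i, ∑ j, ξ i * ξ j * D2 (fun y => invH u y i j) k l y := by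
    intro k l y
    unfold D2
    rw [hqpd k, pd_sum (fun i => ContDiff.sum fun j _ => contDiff_const.mul ((hA i j).pd k))]
    refine Finset.sum_congr rfl fun i _ => ?_
    rw [pd_sum (fun j => contDiff_const.mul ((hA i j).pd k))]
    refine Finset.sum_congr rfl fun j _ => ?_
    rw [pd_mul contDiff_const ((hA i j).pd k), pd_const]
    ring
  have hxi : ξ ⬝ᵥ ν = 1 := by
    rw [hξ, smul_dotProduct, dotProduct_comm, ← hφ0, smul_eq_mul, inv_mul_cancel₀ hφ0p.ne']
  have hq0 : q x * φ0 = 1 := by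
    rw [hqf, hξ]
    have hu' : IsUnit (hessM u x).det := isUnit_iff_ne_zero.mpr (hess_det_ne hH x)
    rw [Matrix.mulVec_smul, Matrix.mulVec_mulVec, invH, Matrix.nonsing_inv_mul _ hu',
      Matrix.one_mulVec, ← hξ, dotProduct_smul, hxi, smul_eq_mul, mul_one,
      inv_mul_cancel₀ hφ0p.ne']
  have key := one_dim (g := fun t => ∑ i, ν i * pd u i (x + t • ν))
    (φ := fun t => ν ⬝ᵥ hessM u (x + t • ν) *ᵥ ν) (k := fun t => q (x + t • ν))
    (fun t => by simpa only [hess_form] using hasDerivAt_line2 hu x ν t)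
    (fun t => hasDerivAt_line hqs x ν t) (fun t => hasDerivAt_line2 hqs x ν t)
    (fun t => hpos _)
    (fun t => by
      have := inv_cs (hH (x + t • ν)) ξ ν
      rw [hxi] at this
      rw [hqf, mul_comm]
      simpa [invH] using this)
    (by simpa using hq0)
    (fun t => by
      have := (le_abs_self _).trans (curv_bound hu hH hF (x + t • ν) ξ ν)
      rw [← hqf] at this
      refine le_trans (le_of_eq ?_) this
      simp only [hqD, Finset.mul_sum]
      rw [Finset.sum_congr rfl fun k _ => Finset.sum_comm]
      rw [Finset.sum_comm]
      refine Finset.sum_congr rfl fun i _ => ?_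
      rw [Finset.sum_congr rfl fun k _ => Finset.sum_comm]
      rw [Finset.sum_comm]
      refine Finset.sum_congr rfl fun j _ => Finset.sum_congr rfl fun k _ =>
        Finset.sum_congr rfl fun l _ => ?_
      ring) hL (ε := ε) (by simpa only [← fderiv_eq_sum] using hε) hεL
  simpa using key

/-- log det of the Hessian -/
def ldet (u : (Fin n → ℝ) → ℝ) (x : Fin n → ℝ) : ℝ := Real.log (hessM u x).det

lemma ldet_sm (hu : Sm u) (hH : ∀ x, (hessM u x).PosDef) : Sm (ldet u) :=
  (Sm_det (hess_sm hu)).log (hess_det_ne hH)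

lemma pd_ldet (hu : Sm u) (hH : ∀ x, (hessM u x).PosDef) (k : Fin n) (x : Fin n → ℝ) :
    pd (ldet u) k x = ∑ i, ∑ j, invH u x i j * MD (hessM u) k x i j := by
  have h := pd_det (hess_sm hu) (hess_det_ne hH) k x
  have hd := ((Sm_det (hess_sm hu)).diff x).hasFDerivAt.log (hess_det_ne hH x)
  have : pd (ldet u) k x = (hessM u x).det⁻¹ * pd (fun y => (hessM u y).det) k x := by
    unfold pd
    rw [show ldet u = fun y => Real.log (hessM u y).det from rfl, hd.fderiv]
    simp
  rw [this, h, ← mul_assoc, inv_mul_cancel₀ (hess_det_ne hH x), one_mul, Matrix.trace]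
  refine Finset.sum_congr rfl fun i _ => ?_
  rw [Matrix.diag_apply, Matrix.mul_apply]
  refine Finset.sum_congr rfl fun j _ => ?_
  rw [T_symm1 hu]
  rfl

lemma div_invH (hu : Sm u) (hH : ∀ x, (hessM u x).PosDef) (j : Fin n) (x : Fin n → ℝ) :
    ∑ i, pd (fun y => invH u y i j) i x = - ∑ b, invH u x b j * pd (ldet u) b x := by
  have h1 : ∀ i, pd (fun y => invH u y i j) i x
      = - ∑ a, ∑ b, invH u x i a * MD (hessM u) i x a b * invH u x b j := by
    intro i
    have : pd (fun y => invH u y i j) i x = MD (invH u) i x i j := rfl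
    rw [this, MD_invH hu hH, Matrix.neg_apply, triple_apply]
  simp only [h1, Finset.sum_neg_distrib]
  congr 1
  simp only [pd_ldet hu hH, Finset.mul_sum]
  rw [Finset.sum_congr rfl fun k _ => Finset.sum_comm]
  rw [Finset.sum_comm]
  refine Finset.sum_congr rfl fun b _ => Finset.sum_congr rfl fun i _ =>
    Finset.sum_congr rfl fun a _ => ?_
  rw [T_symm2 hu x a b i, T_symm1 hu x a i b]
  ring

lemma ldet_subsol (hu : Sm u) (hH : ∀ x, (hessM u x).PosDef)
    (hS : ∀ x, (∑ i, ∑ j, D2 (fun y => invH u y i j) i j x) = 0) (x : Fin n → ℝ) :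
    0 ≤ ∑ i, ∑ j, invH u x i j * D2 (ldet u) i j x := by
  have hA := inv_sm hu hH
  have hL := ldet_sm hu hH
  have h1 : ∑ i, ∑ j, D2 (fun y => invH u y i j) i j x
      = ∑ j, pd (fun y => ∑ i, pd (fun y => invH u y i j) i y) j x := by
    rw [Finset.sum_comm]
    refine Finset.sum_congr rfl fun j _ => ?_
    rw [pd_sum fun i => (hA i j).pd i]
    rfl
  have h2 : ∀ j, pd (fun y => ∑ i, pd (fun y => invH u y i j) i y) j x
      = - ∑ b, (pd (fun y => invH u y b j) j x * pd (ldet u) b x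
          + invH u x b j * D2 (ldet u) b j x) := by
    intro j
    rw [show (fun y => ∑ i, pd (fun y => invH u y i j) i y)
      = fun y => - ∑ b, invH u y b j * pd (ldet u) b y from funext fun y => div_invH hu hH j y,
      pd_neg, pd_sum fun b => (hA b j).mul (hL.pd b)]
    congr 1
    refine Finset.sum_congr rfl fun b _ => ?_
    rw [pd_mul (hA b j) (hL.pd b)]
    rfl
  have h3 : ∀ b, ∑ j, pd (fun y => invH u y b j) j x
      = - ∑ c, invH u x c b * pd (ldet u) c x := by
    intro b
    rw [← div_invH hu hH b x]
    refine Finset.sum_congr rfl fun j _ => ?_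
    rw [show (fun y => invH u y b j) = fun y => invH u y j b from
      funext fun y => inv_symm hH y b j]
  have h4 : ∑ j, ∑ b, pd (fun y => invH u y b j) j x * pd (ldet u) b x
      = - ((fun i => pd (ldet u) i x) ⬝ᵥ invH u x *ᵥ (fun i => pd (ldet u) i x)) := by
    rw [Finset.sum_comm]
    simp only [← Finset.sum_mul, h3]
    rw [dotProduct, ← Finset.sum_neg_distrib]
    refine Finset.sum_congr rfl fun b _ => ?_
    rw [mulVec, dotProduct, neg_mul, mul_comm]
    congr 2
    exact Finset.sum_congr rfl fun c _ => by rw [inv_symm hH x b c]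
  have h5 := hS x
  rw [h1, Finset.sum_congr rfl fun j _ => h2 j, Finset.sum_neg_distrib, neg_eq_zero] at h5
  simp only [Finset.sum_add_distrib] at h5
  rw [h4] at h5
  have h6 := (hH x).inv.posSemidef.dotProduct_mulVec_nonneg (fun i => pd (ldet u) i x)
  simp only [star_trivial] at h6
  rw [Finset.sum_comm]
  change 0 ≤ _ ⬝ᵥ invH u x *ᵥ _ at h6
  linarith

/-- second derivative test -/
lemma second_test {f : (Fin n → ℝ) → ℝ} (hf : Sm f) (x : Fin n → ℝ) (hm : IsLocalMax f x)
    (v : Fin n → ℝ) : ∑ i, ∑ j, v i * v j * D2 f i j x ≤ 0 := by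
  by_contra! hcon
  set h : ℝ → ℝ := fun s => f (x + s • v) with hh
  have d1 : deriv h = fun s => ∑ i, v i * pd f i (x + s • v) :=
    funext fun s => (hasDerivAt_line hf x v s).deriv
  have d2 : deriv (deriv h) = fun s => ∑ i, ∑ j, v i * v j * D2 f i j (x + s • v) := by
    rw [d1]
    exact funext fun s => (hasDerivAt_line2 hf x v s).deriv
  have hc : ContinuousAt h 0 := (hasDerivAt_line hf x v 0).continuousAt
  have hmax : IsLocalMax h 0 := by
    have hl : Filter.Tendsto (fun s : ℝ => x + s • v) (nhds 0) (nhds x) := by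
      have : Continuous (fun s : ℝ => x + s • v) := by fun_prop
      simpa using this.tendsto 0
    have := hl.eventually hm
    filter_upwards [this] with s hs
    simpa [hh] using hs
  have hmin : IsLocalMin h 0 := by
    apply isLocalMin_of_deriv_deriv_pos
    · rw [d2]; simpa using hcon
    · exact hmax.deriv_eq_zero
    · exact hc
  have heq : h =ᶠ[nhds 0] fun _ => h 0 := by
    filter_upwards [hmax, hmin] with s h1 h2
    exact le_antisymm h1 h2
  have : deriv (deriv h) 0 = 0 := by
    rw [(heq.deriv).deriv_eq]
    simp
  rw [d2] at this
  simp at this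
  linarith

lemma no_max (hn : 0 < n) (hu : Sm u) (hH : ∀ x, (hessM u x).PosDef)
    (hS : ∀ x, (∑ i, ∑ j, D2 (fun y => invH u y i j) i j x) = 0) {ε : ℝ} (hε : 0 < ε)
    (x : Fin n → ℝ) : ¬ IsLocalMax (fun y => ldet u y + ε * u y) x := by
  intro hm
  have hL := ldet_sm hu hH
  have hs : Sm (fun y => ldet u y + ε * u y) := hL.add (contDiff_const.mul hu)
  have h1 := trace_nonpos (hH x) (Matrix.of fun i j => D2 (fun y => ldet u y + ε * u y) i j x)
    (fun v => second_test hs x hm v)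
  have h2 : ∀ i j, D2 (fun y => ldet u y + ε * u y) i j x
      = D2 (ldet u) i j x + ε * hessM u x i j := by
    intro i j
    have e : pd (fun y => ldet u y + ε * u y) i = fun y => pd (ldet u) i y + ε * pd u i y := by
      funext y
      rw [pd_add hL (contDiff_const.mul hu), pd_mul contDiff_const hu, pd_const]
      ring
    unfold D2
    rw [e, pd_add (hL.pd i) (contDiff_const.mul (hu.pd i)), pd_mul contDiff_const (hu.pd i),
      pd_const]
    simp [hessM, D2]
  simp only [Matrix.of_apply, h2, mul_add, Finset.sum_add_distrib] at h1
  have h3 := ldet_subsol hu hH hS x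
  have h4 : ∑ i, ∑ j, (hessM u x)⁻¹ i j * (ε * hessM u x i j) = ε * n := by
    have hu' : IsUnit (hessM u x).det := isUnit_iff_ne_zero.mpr (hess_det_ne hH x)
    have := congrArg Matrix.trace (Matrix.nonsing_inv_mul _ hu')
    rw [Matrix.trace_one, Fintype.card_fin, Matrix.trace] at this
    rw [← this, Finset.mul_sum]
    refine Finset.sum_congr rfl fun i _ => ?_
    rw [Matrix.diag_apply, Matrix.mul_apply, Finset.mul_sum]
    refine Finset.sum_congr rfl fun j _ => ?_
    have : hessM u x i j = hessM u x j i := by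
      change pd (pd u i) j x = pd (pd u j) i x
      rw [pd_comm hu]
    rw [this]
    ring
  rw [h4] at h1
  have : (0 : ℝ) < ε * n := mul_pos hε (by exact_mod_cast hn)
  simp only [invH] at h3
  linarith

end Geometry
/-! ### Decay at infinity and conclusion -/

section Final

open Filter Topology

variable {n : ℕ} {u : (Fin n → ℝ) → ℝ}

lemma grad_bound {M : ℝ}
    (hM : ∀ x, Real.sqrt (∑ i, (fderiv ℝ u x (Pi.single i 1)) ^ 2) < M) :
    ∃ m : ℝ, 0 < m ∧ ∀ x v, |fderiv ℝ u x v| ≤ m * ‖v‖ := by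
  have hM0 : 0 < M := lt_of_le_of_lt (Real.sqrt_nonneg _) (hM 0)
  refine ⟨n * M + 1, by positivity, fun x v => ?_⟩
  rw [fderiv_eq_sum]
  refine (Finset.abs_sum_le_sum_abs _ _).trans ?_
  have : ∀ i ∈ Finset.univ, |v i * pd u i x| ≤ ‖v‖ * M := by
    intro i _
    rw [abs_mul]
    have h1 : |v i| ≤ ‖v‖ := norm_le_pi_norm v i
    have h2 : |pd u i x| ≤ M := by
      refine le_trans (Real.abs_le_sqrt ?_) (hM x).le
      exact Finset.single_le_sum (f := fun i => (fderiv ℝ u x (Pi.single i 1)) ^ 2)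
        (fun i _ => sq_nonneg _) (Finset.mem_univ i)
    gcongr
  refine (Finset.sum_le_card_nsmul _ _ _ this).trans ?_
  simp only [Finset.card_univ, Fintype.card_fin, nsmul_eq_mul]
  nlinarith [norm_nonneg v]

lemma lip_bound (hu : Sm u) {m : ℝ} (hm0 : 0 < m) (hm : ∀ x v, |fderiv ℝ u x v| ≤ m * ‖v‖)
    (x y : Fin n → ℝ) : |u y - u x| ≤ m * ‖y - x‖ := by
  have := convex_univ.norm_image_sub_le_of_norm_fderiv_le (f := u) (𝕜 := ℝ) (C := m)
    (fun x _ => hu.diff x)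
    (fun x _ => ContinuousLinearMap.opNorm_le_bound _ hm0.le fun v => by
      simpa using hm x v) (Set.mem_univ x) (Set.mem_univ y)
  simpa using this

lemma radial_mono (hu : Sm u) (hH : ∀ x, (hessM u x).PosDef) (ν : Fin n → ℝ) :
    Monotone (fun s : ℝ => fderiv ℝ u (s • ν) ν) := by
  refine monotone_of_hasDerivAt_nonneg (f' := fun s => ν ⬝ᵥ hessM u (s • ν) *ᵥ ν)
    (fun s => ?_) (fun s => ?_)
  · have := hasDerivAt_line2 hu 0 ν s
    simpa only [hess_form, zero_add, fderiv_eq_sum] using this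
  · simpa using (hH (s • ν)).posSemidef.dotProduct_mulVec_nonneg ν

lemma radial_mvt (hu : Sm u) (hH : ∀ x, (hessM u x).PosDef) (ν : Fin n → ℝ) {s : ℝ}
    (hs : 0 < s) :
    fderiv ℝ u (s • ν) ν ≤ (u ((2 * s) • ν) - u (s • ν)) / s ∧
    (u ((2 * s) • ν) - u (s • ν)) / s ≤ fderiv ℝ u ((2 * s) • ν) ν := by
  have hd : ∀ t, HasDerivAt (fun t : ℝ => u (t • ν)) (fderiv ℝ u (t • ν) ν) t := fun t => by
    have := hasDerivAt_line hu 0 ν t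
    simpa only [zero_add, ← fderiv_eq_sum] using this
  obtain ⟨c, hc, hc'⟩ := exists_hasDerivAt_eq_slope (fun t : ℝ => u (t • ν))
    (fun t => fderiv ℝ u (t • ν) ν) (show s < 2 * s by linarith)
    (fun t _ => (hd t).continuousAt.continuousWithinAt) (fun t _ => hd t)
  have e : 2 * s - s = s := by ring
  rw [e] at hc'
  rw [← hc']
  exact ⟨radial_mono hu hH ν hc.1.le, radial_mono hu hH ν hc.2.le⟩

lemma radial_decay (hu : Sm u) (hH : ∀ x, (hessM u x).PosDef) {m : ℝ} (hm0 : 0 < m)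
    (hm : ∀ x v, |fderiv ℝ u x v| ≤ m * ‖v‖) {ε : ℝ} (hε : 0 < ε) :
    ∃ R : ℝ, ∀ s, R ≤ s → ∀ ν : Fin n → ℝ, ‖ν‖ = 1 →
      fderiv ℝ u ((s + 1) • ν) ν - fderiv ℝ u ((s - 1) • ν) ν ≤ ε := by
  set F : ℝ → (Fin n → ℝ) → ℝ := fun s ν => fderiv ℝ u (s • ν) ν with hF
  set Φ : (Fin n → ℝ) → ℝ := fun ν => ⨆ s, F s ν with hΦ
  have hbdd : ∀ ν, BddAbove (Set.range fun s => F s ν) := fun ν =>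
    ⟨m * ‖ν‖, by rintro _ ⟨s, rfl⟩; exact (le_abs_self _).trans (hm _ _)⟩
  have hmono : ∀ ν, Monotone fun s => F s ν := fun ν => radial_mono hu hH ν
  have hlim : ∀ ν, Tendsto (fun s => F s ν) atTop (𝓝 (Φ ν)) := fun ν =>
    tendsto_atTop_ciSup (hmono ν) (hbdd ν)
  have hle : ∀ s ν, F s ν ≤ Φ ν := fun s ν => le_ciSup (hbdd ν) s
  have hlim2 : ∀ ν, Tendsto (fun s : ℝ => (u ((2 * s) • ν) - u (s • ν)) / s) atTop (𝓝 (Φ ν)) := by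
    intro ν
    refine tendsto_of_tendsto_of_tendsto_of_le_of_le' (hlim ν) tendsto_const_nhds ?_ ?_
    · filter_upwards [eventually_gt_atTop 0] with s hs
      exact (radial_mvt hu hH ν hs).1
    · filter_upwards [eventually_gt_atTop 0] with s hs
      exact (radial_mvt hu hH ν hs).2.trans (hle _ _)
  have hΦlip : ∀ ν ν', |Φ ν - Φ ν'| ≤ 3 * m * ‖ν - ν'‖ := by
    intro ν ν'
    refine le_of_tendsto ((hlim2 ν).sub (hlim2 ν')).abs ?_
    filter_upwards [eventually_gt_atTop 0] with s hs
    have h1 := lip_bound hu hm0 hm ((2 * s) • ν') ((2 * s) • ν)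
    have h2 := lip_bound hu hm0 hm (s • ν') (s • ν)
    rw [← smul_sub, norm_smul, Real.norm_of_nonneg (by positivity)] at h1 h2
    rw [← sub_div, abs_div, abs_of_pos hs, div_le_iff₀ hs]
    rw [abs_le] at *
    constructor <;> nlinarith [h1.1, h1.2, h2.1, h2.2]
  have hΦc : Continuous Φ := by
    have : LipschitzWith (Real.toNNReal (3 * m)) Φ := LipschitzWith.of_dist_le_mul fun x y => by
      rw [Real.dist_eq, dist_eq_norm, Real.coe_toNNReal _ (by positivity)]
      exact hΦlip x y
    exact this.continuous
  have hFc : ∀ s, Continuous (F s) := fun s => by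
    have h : ContDiff ℝ (⊤ : ℕ∞) (fderiv ℝ u) := hu.fderiv_right (by simp)
    have hc := h.continuous
    exact (hc.comp (continuous_const_smul s)).clm_apply continuous_id
  have hunif := Monotone.tendstoUniformlyOn_of_forall_tendsto
    (isCompact_sphere (0 : Fin n → ℝ) 1) (fun s => (hFc s).continuousOn) (fun ν _ => hmono ν)
    hΦc.continuousOn (fun ν _ => hlim ν)
  rw [Metric.tendstoUniformlyOn_iff] at hunif
  obtain ⟨R, hR⟩ := eventually_atTop.1 (hunif ε hε)
  refine ⟨R + 1, fun s hs ν hν => ?_⟩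
  have h1 := hR (s - 1) (by linarith) ν (by simpa using hν)
  rw [Real.dist_eq] at h1
  have h2 := (abs_lt.1 h1).2
  have h3 := hle (s + 1) ν
  simp only [hF] at h2 h3
  linarith

lemma hess_entries (hu : Sm u) (hH : ∀ x, (hessM u x).PosDef) (hF : ∀ x, Fsq u x ≤ 1) {m : ℝ}
    (hm0 : 0 < m) (hm : ∀ x v, |fderiv ℝ u x v| ≤ m * ‖v‖) :
    ∃ C : ℝ, 1 ≤ C ∧ ∀ x i j, |hessM u x i j| ≤ C := by
  refine ⟨16 * m ^ 2 + 1, by nlinarith, fun x i j => ?_⟩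
  have hdiag : ∀ i, hessM u x i i ≤ 16 * m ^ 2 := by
    intro i
    have hν : (Pi.single i 1 : Fin n → ℝ) ≠ 0 := by simp
    have hnorm : ‖(Pi.single i 1 : Fin n → ℝ)‖ = 1 := by
      refine le_antisymm ((pi_norm_le_iff_of_nonneg zero_le_one).mpr fun j => ?_) ?_
      · by_cases h : j = i
        · subst h; simp
        · simp [h]
      · have := norm_le_pi_norm (Pi.single i 1 : Fin n → ℝ) i
        simpa using this
    have := hess_bound hu hH hF x (Pi.single i 1) hν (ε := 2 * m) (L := 1 / (4 * m))
      (by positivity) (by field_simp; norm_num) (by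
        have h1 := (abs_le.1 (hm (x + (1 / (4 * m)) • Pi.single i 1) (Pi.single i 1))).2
        have h2 := (abs_le.1 (hm (x + (-(1 / (4 * m))) • Pi.single i 1) (Pi.single i 1))).1
        rw [hnorm] at h1 h2
        linarith)
    have e : 2 * (2 * m) / (1 / (4 * m)) = 16 * m ^ 2 := by field_simp; norm_num
    rw [e] at this
    simpa using this
  have hsym : hessM u x j i = hessM u x i j := by
    change pd (pd u j) i x = pd (pd u i) j x
    rw [pd_comm hu]
  have hp := (hH x).posSemidef.dotProduct_mulVec_nonneg (Pi.single i 1 + Pi.single j 1)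
  have hq := (hH x).posSemidef.dotProduct_mulVec_nonneg (Pi.single i 1 - Pi.single j 1)
  simp [Matrix.mulVec_add, Matrix.mulVec_sub, add_dotProduct, sub_dotProduct, hsym] at hp hq
  have h1 := hdiag i
  have h2 := hdiag j
  rw [abs_le]
  constructor <;> linarith

lemma main_contra (hn : 0 < n) (hu : Sm u) (hH : ∀ x, (hessM u x).PosDef)
    (hS : ∀ x, (∑ i, ∑ j, D2 (fun y => invH u y i j) i j x) = 0) (hF : ∀ x, Fsq u x ≤ 1)
    {m : ℝ} (hm0 : 0 < m) (hm : ∀ x v, |fderiv ℝ u x v| ≤ m * ‖v‖) : False := by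
  obtain ⟨C, hC1, hC⟩ := hess_entries hu hH hF hm0 hm
  set K : ℝ := n * (n * ((Nat.factorial n : ℝ) * C ^ n)) with hK
  have hn' : (0 : ℝ) < n := by exact_mod_cast hn
  have hKp : 0 < K := by
    have : (0 : ℝ) < Nat.factorial n := by exact_mod_cast Nat.factorial_pos n
    positivity
  set δ := Real.exp (ldet u 0 - 1) with hδ
  have hδp : 0 < δ := Real.exp_pos _
  set ε := min (1 / 2) (δ / (2 * K)) with hε
  have hεp : 0 < ε := lt_min (by norm_num) (by positivity)
  obtain ⟨R0, hR0⟩ := radial_decay hu hH hm0 hm hεp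
  set R := max R0 1 with hR
  have hRp : 0 < R := lt_of_lt_of_le one_pos (le_max_right _ _)
  have hdecay : ∀ x : Fin n → ℝ, ‖x‖ = R → ldet u x ≤ ldet u 0 - 1 := by
    intro x hx
    set ν : Fin n → ℝ := R⁻¹ • x with hν
    have hν1 : ‖ν‖ = 1 := by
      rw [hν, norm_smul, hx, Real.norm_of_nonneg (by positivity), inv_mul_cancel₀ hRp.ne']
    have hxν : x = R • ν := by rw [hν, smul_smul, mul_inv_cancel₀ hRp.ne', one_smul]
    have h1 := hR0 R (le_max_left _ _) ν hν1
    have h2 := hess_bound hu hH hF x ν (fun h => by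
        rw [h, norm_zero] at hν1
        exact zero_ne_one hν1) one_pos (ε := ε)
      (by rw [mul_one]; exact min_le_left _ _)
      (by
        have e1 : x + (1 : ℝ) • ν = (R + 1) • ν := by rw [hxν, add_smul]
        have e2 : x + (-1 : ℝ) • ν = (R - 1) • ν := by rw [hxν, sub_smul, neg_smul, sub_eq_add_neg]
        rw [e1, e2]
        exact h1)
    have h3 := det_bound (hH x) hC1 (hC x) ν hν1
    rw [ldet, Real.log_le_iff_le_exp (hH x).det_pos, ← hδ]
    refine h3.trans ?_
    rw [← hK]
    have h4 : ε ≤ δ / (2 * K) := min_le_right _ _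
    calc _ ≤ (2 * ε / 1) * K := mul_le_mul_of_nonneg_right h2 hKp.le
      _ ≤ (2 * (δ / (2 * K)) / 1) * K := by gcongr
      _ = δ := by field_simp
  set η : ℝ := 1 / (2 * (m * R)) with hη
  have hηp : 0 < η := by positivity
  have hcont : Continuous (fun y => ldet u y + η * u y) :=
    (ldet_sm hu hH).continuous.add (continuous_const.mul hu.continuous)
  obtain ⟨p, hp, hmax⟩ := (isCompact_closedBall (0 : Fin n → ℝ) R).exists_isMaxOn
    ⟨0, by simpa using hRp.le⟩ hcont.continuousOn
  have h0 : ldet u 0 + η * u 0 ≤ ldet u p + η * u p := hmax (by simpa using hRp.le)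
  have hpR : ‖p‖ ≤ R := by simpa using hp
  have hlt : ‖p‖ < R := by
    refine lt_of_le_of_ne hpR fun h => ?_
    have h1 := hdecay p h
    have h2 := (le_abs_self _).trans (lip_bound hu hm0 hm 0 p)
    rw [sub_zero, h] at h2
    have h3 : η * (u p - u 0) ≤ η * (m * R) := mul_le_mul_of_nonneg_left h2 hηp.le
    have h4 : η * (m * R) = 1 / 2 := by rw [hη]; field_simp
    nlinarith
  exact no_max hn hu hH hS hηp p (hmax.isLocalMax
    (mem_of_superset (Metric.isOpen_ball.mem_nhds (by simpa using hlt)) Metric.ball_subset_closedBall))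

end Final

/-- there is no smooth strictly convex function `u : ℝⁿ → ℝ`
(`n ≥ 1`) with `∑(u^{ij})_{,ij} = 0`, curvature bound `|F|² ≤ 1`, and
uniformly bounded gradient. -/
theorem stmt14 (n : ℕ) (hn : 0 < n) :
    ¬ ∃ u : (Fin n → ℝ) → ℝ,
      ContDiff ℝ (⊤ : ℕ∞) u ∧
      (∀ x, (hessM u x).PosDef) ∧
      (∀ x, (∑ i, ∑ j, D2 (fun y => invH u y i j) i j x) = 0) ∧
      (∀ x, Fsq u x ≤ 1) ∧
      (∃ M : ℝ, ∀ x, Real.sqrt (∑ i, (fderiv ℝ u x (Pi.single i 1)) ^ 2) < M) := by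
  rintro ⟨u, hu, hH, hS, hF, M, hM⟩
  obtain ⟨m, hm0, hm⟩ := grad_bound hM
  exact main_contra hn hu hH hS hF hm0 hm

end
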